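/- Let I ⊆ (0,∞) and J ⊆ ℝ be nonempty open intervals, let β(s) = (1, s, s), let γ(s) = (x(s), y(s), z(s)) be smooth on I with ⟨γ'(s), β(s)⟩ = 0 for all s ∈ I, and let V = (v₁, v₂, v₃) ∈ ℝ³. Suppose that for every s ∈ I and every t ∈ J the ruled surface X(s,t) = γ(s) + t·β(s) is nondegenerate (EG − F² ≠ 0) and satisfies the translating soliton equation (★). Then, with a = (0,1,1), the identity 2·(γ'(s), β(s), V)·⟨a, γ'(s)⟩ = (a, β(s), V)·⟨γ'(s), γ'(s)⟩ holds for all s ∈ I. -/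

import Mathlib

noncomputable section

open Real

/-- The Lorentzian inner product on `𝕃³ = ℝ³`: `⟨x,y⟩ = x₁y₁ + x₂y₂ − x₃y₃`. -/
def Lprod (u v : Fin 3 → ℝ) : ℝ := u 0 * v 0 + u 1 * v 1 - u 2 * v 2

/-- The mixed product `(u,v,w) = det(u,v,w)`. -/
def mixed (u v w : Fin 3 → ℝ) : ℝ :=
  u 0 * (v 1 * w 2 - v 2 * w 1) - u 1 * (v 0 * w 2 - v 2 * w 0) +
    u 2 * (v 0 * w 1 - v 1 * w 0)

/-- `X_s = γ' + t β'` for the ruled surface `X(s,t) = γ(s) + t β(s)`. -/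
def Xs (γ β : ℝ → Fin 3 → ℝ) (s t : ℝ) : Fin 3 → ℝ := deriv γ s + t • deriv β s

/-- `X_ss = γ'' + t β''`. -/
def Xss (γ β : ℝ → Fin 3 → ℝ) (s t : ℝ) : Fin 3 → ℝ :=
  deriv (deriv γ) s + t • deriv (deriv β) s

/-- Nondegeneracy at `(s,t)`: `EG − F² ≠ 0`. -/
def Nondeg (γ β : ℝ → Fin 3 → ℝ) (s t : ℝ) : Prop :=
  Lprod (Xs γ β s t) (Xs γ β s t) * Lprod (β s) (β s) -
      (Lprod (Xs γ β s t) (β s)) ^ 2 ≠ 0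

/-- The translating soliton equation (★) of the IMCF at `(s,t)`:
`(X_s,X_t,V)·[G·(X_s,X_t,X_ss) − 2F·(X_s,X_t,X_st)] = 2(EG − F²)²`,
where `X_t = β` and `X_st = β'`. -/
def SolitonEq (γ β : ℝ → Fin 3 → ℝ) (V : Fin 3 → ℝ) (s t : ℝ) : Prop :=
  mixed (Xs γ β s t) (β s) V *
      (Lprod (β s) (β s) * mixed (Xs γ β s t) (β s) (Xss γ β s t) -
        2 * Lprod (Xs γ β s t) (β s) * mixed (Xs γ β s t) (β s) (deriv β s)) =
    2 * (Lprod (Xs γ β s t) (Xs γ β s t) * Lprod (β s) (β s) -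
          (Lprod (Xs γ β s t) (β s)) ^ 2) ^ 2

/-- A real quadratic polynomial vanishing on a nonempty open set has zero coefficients. -/
lemma quadratic_coeffs_eq_zero_of_isOpen {J : Set ℝ} (hJ : IsOpen J) (hne : J.Nonempty)
    {a b c : ℝ} (h : ∀ t ∈ J, a + b * t + c * t ^ 2 = 0) : a = 0 ∧ b = 0 ∧ c = 0 := by
  obtain ⟨t, ht⟩ := hne
  obtain ⟨ε, hε, hball⟩ := Metric.isOpen_iff.mp hJ t ht
  have hplus : t + ε / 2 ∈ J := hball (by
    rw [Metric.mem_ball, Real.dist_eq, add_sub_cancel_left, abs_of_pos] <;> linarith)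
  have hminus : t - ε / 2 ∈ J := hball (by
    rw [Metric.mem_ball, Real.dist_eq, abs_sub_comm, sub_sub_cancel, abs_of_pos] <;> linarith)
  have h₀ := h t ht
  have h₁ := h _ hplus
  have h₂ := h _ hminus
  have hc : c = 0 := by
    have : c * ε ^ 2 = 0 := by linear_combination 2 * h₁ + 2 * h₂ - 4 * h₀
    simpa [hε.ne'] using this
  subst hc
  have hb : b = 0 := by
    have : b * ε = 0 := by linear_combination h₁ - h₂
    simpa [hε.ne'] using this
  subst hb
  exact ⟨by linarith, rfl, rfl⟩

/-- If a product of two affine functions equals twice the square of the affine function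
`e + 2 m t` with `m ≠ 0` on a nonempty open set, then the first factor has the same root. -/
lemma two_mul_mul_eq_of_affine_mul_affine {J : Set ℝ} (hJ : IsOpen J) (hne : J.Nonempty)
    {A B C D e m : ℝ} (hm : m ≠ 0)
    (h : ∀ t ∈ J, (A + t * B) * (C + t * D) = 2 * (e + 2 * t * m) ^ 2) :
    2 * A * m = B * e := by
  obtain ⟨h₀, h₁, h₂⟩ := quadratic_coeffs_eq_zero_of_isOpen hJ hne
    (a := A * C - 2 * e ^ 2) (b := A * D + B * C - 8 * e * m) (c := B * D - 8 * m ^ 2)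
    (fun t ht => by linear_combination h t ht)
  have hsq : (A * D - 4 * e * m) ^ 2 = 0 := by
    linear_combination A * D * h₁ - B * D * h₀ - 2 * e ^ 2 * h₂
  have hAD : A * D - 4 * e * m = 0 := pow_eq_zero_iff (two_ne_zero) |>.mp hsq
  have : 4 * m * (2 * A * m - B * e) = 0 := by
    linear_combination B * hAD - A * h₂
  have := (mul_eq_zero.mp this).resolve_left (mul_ne_zero four_ne_zero hm)
  linarith

lemma hasDerivAt_director (s : ℝ) :
    HasDerivAt (fun s : ℝ => (![1, s, s] : Fin 3 → ℝ)) ![0, 1, 1] s := by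
  rw [hasDerivAt_pi]
  intro i
  fin_cases i
  · exact hasDerivAt_const s 1
  · exact hasDerivAt_id s
  · exact hasDerivAt_id s

/-- for a non-cylindrical ruled IMCF translating soliton with director
`β(s) = (1,s,s)`, the identity `2(γ',β,V)⟨a,γ'⟩ = (a,β,V)⟨γ',γ'⟩` holds with
`a = (0,1,1)`. -/
theorem noncylindrical_algebraic_identity
    (I J : Set ℝ) (hIopen : IsOpen I) (hIne : I.Nonempty) (hIconn : I.OrdConnected)
    (hIpos : I ⊆ Set.Ioi (0 : ℝ))
    (hJopen : IsOpen J) (hJne : J.Nonempty) (hJconn : J.OrdConnected)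
    (x y z : ℝ → ℝ) (hx : ContDiffOn ℝ (⊤ : ℕ∞) x I) (hy : ContDiffOn ℝ (⊤ : ℕ∞) y I)
    (hz : ContDiffOn ℝ (⊤ : ℕ∞) z I)
    (γ β : ℝ → Fin 3 → ℝ)
    (hγdef : ∀ s, γ s = ![x s, y s, z s]) (hβdef : ∀ s, β s = ![1, s, s])
    (horth : ∀ s ∈ I, Lprod (deriv γ s) (β s) = 0)
    (v₁ v₂ v₃ : ℝ) (V : Fin 3 → ℝ) (hV : V = ![v₁, v₂, v₃])
    (hnd : ∀ s ∈ I, ∀ t ∈ J, Nondeg γ β s t)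
    (hsol : ∀ s ∈ I, ∀ t ∈ J, SolitonEq γ β V s t) :
    ∀ s ∈ I, 2 * mixed (deriv γ s) (β s) V * Lprod ![0, 1, 1] (deriv γ s) =
      mixed ![0, 1, 1] (β s) V * Lprod (deriv γ s) (deriv γ s) := by
  intro s hs
  obtain rfl : β = fun s => ![1, s, s] := funext hβdef
  have hβ' : deriv (fun s : ℝ => (![1, s, s] : Fin 3 → ℝ)) = fun _ => ![0, 1, 1] :=
    funext fun s => (hasDerivAt_director s).deriv
  have ho := horth s hs
  have hstar := hsol s hs
  simp only [SolitonEq, Xs, Xss, hβ', deriv_const] at hstar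
  generalize deriv (deriv γ) s = k at hstar
  generalize deriv γ s = g at ho hstar ⊢
  have horth' : g 0 + s * (g 1 - g 2) = 0 := by
    simp [Lprod] at ho
    linear_combination ho
  by_cases hm : g 1 - g 2 = 0
  · have h0 : g 0 = 0 := by linear_combination horth' - s * hm
    have ha : Lprod ![0, 1, 1] g = 0 := by
      simp [Lprod]
      linear_combination hm
    have he : Lprod g g = 0 := by
      simp only [Lprod]
      linear_combination g 0 * h0 + (g 1 + g 2) * hm
    rw [ha, he, mul_zero, mul_zero]
  · have ha : Lprod ![0, 1, 1] g = g 1 - g 2 := by simp [Lprod]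
    rw [ha]
    refine two_mul_mul_eq_of_affine_mul_affine hJopen hJne hm
      (C := mixed g ![1, s, s] k) (D := mixed ![0, 1, 1] ![1, s, s] k) fun t ht => ?_
    have hF : Lprod (g + t • ![0, 1, 1]) ![1, s, s] = 0 := by
      simp [Lprod]
      linear_combination horth'
    have hG : Lprod ![1, s, s] ![1, s, s] = 1 := by simp [Lprod]
    have hE : Lprod (g + t • ![0, 1, 1]) (g + t • ![0, 1, 1]) =
        Lprod g g + 2 * t * (g 1 - g 2) := by
      simp [Lprod]
      ring
    have hmixed (w : Fin 3 → ℝ) : mixed (g + t • ![0, 1, 1]) ![1, s, s] w =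
        mixed g ![1, s, s] w + t * mixed ![0, 1, 1] ![1, s, s] w := by
      simp [mixed]
      ring
    have h := hstar t ht
    rw [hF, hG, hE, smul_zero, add_zero, hmixed, hmixed k] at h
    linear_combination h
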